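/- arXiv:1702.07417 — 3 statements merged into one kernel-verified Lean document; each statement's English description precedes it below -/
import Mathlib

section
/- Let H be a unit-cofinite subgroup of K^×, and let x ∈ Y/H be represented by y ∈ Y. Let m be the smallest positive integer such that ε^m Λ_y = Λ_y and at least one of ε^m, −ε^m lies in H, and let δ = ±ε^m be chosen so that δ ∈ H (taking δ = ε^m if both lie in H). Then there is a unique g ∈ Γ_x satisfying g·y = y·δ, and the quotient Γ_x/(Γ_x ∩ {±I}) is cyclic, generated by the image of g; moreover every element of Γ_x equals ±g^k for some integer k. -/
open scoped Pointwise Classical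
open Matrix NumberField

noncomputable section

namespace AD

/-- The set `Y` of column vectors `(a,b)ᵀ ∈ K²` with `b ≠ 0` and `a/b ∉ ℚ`. -/
def Y (K : Type*) [Field K] [NumberField K] : Set (Fin 2 → K) :=
  {y | y 1 ≠ 0 ∧ ∀ r : ℚ, y 0 ≠ algebraMap ℚ K r * y 1}

/-- The elements of `Y`, as a type. -/
def Ysub (K : Type*) [Field K] [NumberField K] := {y : Fin 2 → K // y ∈ Y K}

/-- The lattice `Λ_y = ℤ·(y 0) + ℤ·(y 1)` spanned by the entries of `y`. -/
def lat {K : Type*} [Field K] [NumberField K] (y : Fin 2 → K) : Submodule ℤ K :=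
  Submodule.span ℤ {y 0, y 1}

/-- A lattice in `K`: a free `ℤ`-submodule of rank `2`; equivalently (since `K` is a
`2`-dimensional `ℚ`-vector space) the `ℤ`-span of a pair of `ℚ`-linearly independent
elements of `K`. -/
def IsLat {K : Type*} [Field K] [NumberField K] (L : Submodule ℤ K) : Prop :=
  ∃ y : Fin 2 → K, LinearIndependent ℚ y ∧ L = lat y

/-- Scaling of a `ℤ`-submodule of `K` by `c ∈ K`:  `c • L`. -/
def smulLat {K : Type*} [Field K] [NumberField K] (c : K) (L : Submodule ℤ K) :
    Submodule ℤ K :=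
  L.map (LinearMap.mulLeft ℤ c)

/-- The (left) action of a rational `2 × 2` matrix on column vectors in `K²`. -/
def act {K : Type*} [Field K] [NumberField K] (g : Matrix (Fin 2) (Fin 2) ℚ)
    (y : Fin 2 → K) : Fin 2 → K :=
  (g.map (algebraMap ℚ K)).mulVec y

/-- The right scalar action of `K` on column vectors in `K²`: `y·c`. -/
def rsc {K : Type*} [Field K] [NumberField K] (y : Fin 2 → K) (c : K) : Fin 2 → K :=
  fun i => y i * c

/-- `GL(2,ℤ)`, viewed as the set of rational `2 × 2` matrices with integral entries
and determinant `±1`. -/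
def GLZset : Set (Matrix (Fin 2) (Fin 2) ℚ) :=
  {g | (∀ i j, ∃ a : ℤ, g i j = (a : ℚ)) ∧ (g.det = 1 ∨ g.det = -1)}

end AD
namespace AD

/-- The image in `K^×` of a unit of `𝒪`. -/
def unitToK (K : Type*) [Field K] [NumberField K] (u : (𝓞 K)ˣ) : Kˣ :=
  Units.map (algebraMap (𝓞 K) K).toMonoidHom u

/-- The stabilizer `Γ_x` (in `GL(2,ℤ)`) of the class `x ∈ Y/H` of `y ∈ Y`, described on
the representative `y`: the matrices `η ∈ GL(2,ℤ)` with `η·y = y·c` for some `c ∈ H`. -/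
def stabSet (K : Type*) [Field K] [NumberField K] (H : Subgroup Kˣ) (y : Ysub K) :
    Set (Matrix (Fin 2) (Fin 2) ℚ) :=
  {η | η ∈ GLZset ∧ ∃ c ∈ H, act η y.1 = rsc y.1 (c : K)}

section Action

variable {K : Type*} [Field K] [NumberField K]

lemma act_apply (g : Matrix (Fin 2) (Fin 2) ℚ) (y : Fin 2 → K) (i : Fin 2) :
    act g y i = algebraMap ℚ K (g i 0) * y 0 + algebraMap ℚ K (g i 1) * y 1 := by
  simp [act, Matrix.mulVec, dotProduct, Fin.sum_univ_two]

lemma act_mul (g h : Matrix (Fin 2) (Fin 2) ℚ) (y : Fin 2 → K) :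
    act (g * h) y = act g (act h y) := by
  rw [act, act, act, Matrix.map_mul, Matrix.mulVec_mulVec]

lemma act_one (y : Fin 2 → K) : act 1 y = y := by
  simp [act]

lemma act_neg (g : Matrix (Fin 2) (Fin 2) ℚ) (y : Fin 2 → K) :
    act (-g) y = rsc (act g y) (-1) := by
  funext i
  simp only [act_apply, rsc, Matrix.neg_apply, map_neg]
  ring

lemma act_rsc (g : Matrix (Fin 2) (Fin 2) ℚ) (y : Fin 2 → K) (c : K) :
    act g (rsc y c) = rsc (act g y) c := by
  funext i
  simp only [act_apply, rsc]
  ring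

lemma rsc_rsc (y : Fin 2 → K) (c d : K) : rsc (rsc y c) d = rsc y (c * d) := by
  funext i
  simp only [rsc, mul_assoc]

lemma rsc_one (y : Fin 2 → K) : rsc y 1 = y := by
  funext i
  simp only [rsc, mul_one]

lemma eq_zero_of_rat_combination_eq_zero {y : Fin 2 → K} (hy : y ∈ Y K) {p q : ℚ}
    (h : algebraMap ℚ K p * y 0 + algebraMap ℚ K q * y 1 = 0) : p = 0 ∧ q = 0 := by
  have hp : p = 0 := by
    by_contra hp
    have hp' : algebraMap ℚ K p ≠ 0 := by simpa using hp
    refine hy.2 (-q / p) ?_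
    rw [map_div₀, map_neg]
    field_simp
    linear_combination h
  subst hp
  simpa [hy.1] using h

/-- A matrix is determined by its action on an element of `Y`. -/
lemma act_injective {y : Fin 2 → K} (hy : y ∈ Y K) {g h : Matrix (Fin 2) (Fin 2) ℚ}
    (hgh : act g y = act h y) : g = h := by
  have key (i : Fin 2) : g i 0 - h i 0 = 0 ∧ g i 1 - h i 1 = 0 := by
    refine eq_zero_of_rat_combination_eq_zero hy ?_
    have := congrFun hgh i
    rw [act_apply, act_apply] at this
    rw [map_sub, map_sub]
    linear_combination this
  ext i j
  fin_cases j
  · exact sub_eq_zero.mp (key i).1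
  · exact sub_eq_zero.mp (key i).2

/-- If `g · y = y · c` then `g ^ k · y = y · c ^ k` for every integer `k`. -/
lemma act_zpow {g : Matrix (Fin 2) (Fin 2) ℚ} (hg : IsUnit g.det) {y : Fin 2 → K} {c : Kˣ}
    (h : act g y = rsc y (c : K)) (k : ℤ) : act (g ^ k) y = rsc y ((c ^ k : Kˣ) : K) := by
  induction k with
  | zero => simp [act_one, rsc_one]
  | succ n ih =>
    rw [Matrix.zpow_add_one hg, act_mul, h, act_rsc, ih, rsc_rsc, _root_.zpow_add_one, Units.val_mul]
  | pred n ih =>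
    have hmul : g ^ (-(n : ℤ)) = g ^ (-(n : ℤ) - 1) * g := by
      rw [← Matrix.zpow_add_one hg, sub_add_cancel]
    rw [hmul, act_mul, h, act_rsc] at ih
    have := congrArg (fun z => rsc z ((c⁻¹ : Kˣ) : K)) ih
    simp only [rsc_rsc, ← Units.val_mul, mul_inv_cancel, Units.val_one, rsc_one] at this
    rw [this, _root_.zpow_sub_one]

end Action

lemma mem_GLZset_iff {g : Matrix (Fin 2) (Fin 2) ℚ} :
    g ∈ GLZset ↔ ∃ A : Matrix (Fin 2) (Fin 2) ℤ, IsUnit A.det ∧ g = A.map (Int.castRingHom ℚ) := by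
  constructor
  · rintro ⟨hint, hdet⟩
    choose A hA using hint
    have hg : g = (Matrix.of A).map (Int.castRingHom ℚ) := by
      ext i j
      simp [hA]
    refine ⟨Matrix.of A, ?_, hg⟩
    have hd : g.det = ((Matrix.of A).det : ℚ) := by
      rw [hg]
      exact (RingHom.map_det (Int.castRingHom ℚ) (Matrix.of A)).symm
    rw [hd] at hdet
    rw [Int.isUnit_iff]
    exact_mod_cast hdet
  · rintro ⟨A, hA, rfl⟩
    refine ⟨fun i j => ⟨A i j, by simp⟩, ?_⟩
    have hd : (A.map (Int.castRingHom ℚ)).det = (A.det : ℚ) :=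
      (RingHom.map_det (Int.castRingHom ℚ) A).symm
    rw [hd]
    rw [Int.isUnit_iff] at hA
    exact_mod_cast hA

lemma isUnit_det_of_mem_GLZset {g : Matrix (Fin 2) (Fin 2) ℚ} (hg : g ∈ GLZset) :
    IsUnit g.det := by
  rcases hg.2 with h | h <;> simp [h]

lemma inv_mem_GLZset {g : Matrix (Fin 2) (Fin 2) ℚ} (hg : g ∈ GLZset) : g⁻¹ ∈ GLZset := by
  obtain ⟨A, hA, rfl⟩ := mem_GLZset_iff.mp hg
  refine mem_GLZset_iff.mpr ⟨A⁻¹, ?_, ?_⟩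
  · exact Matrix.isUnit_nonsing_inv_det A hA
  · refine Matrix.inv_eq_left_inv ?_
    rw [← Matrix.map_mul, Matrix.nonsing_inv_mul A hA]
    simp

section Lattice

variable {K : Type*} [Field K] [NumberField K]

lemma mem_lat {y : Fin 2 → K} {z : K} :
    z ∈ lat y ↔ ∃ a b : ℤ, (a : K) * y 0 + (b : K) * y 1 = z := by
  simp [lat, Submodule.mem_span_pair, zsmul_eq_mul]

lemma mem_lat_apply (y : Fin 2 → K) (i : Fin 2) : y i ∈ lat y :=
  Submodule.subset_span (by fin_cases i <;> simp)

lemma smulLat_le_iff {c : K} {y : Fin 2 → K} {L : Submodule ℤ K} :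
    smulLat c (lat y) ≤ L ↔ ∀ i, y i * c ∈ L := by
  rw [smulLat, lat, Submodule.map_span, Submodule.span_le]
  simp [Set.image_pair, Set.insert_subset_iff, Fin.forall_fin_two, mul_comm c]

lemma smulLat_one (L : Submodule ℤ K) : smulLat 1 L = L := by
  ext z
  simp [smulLat]

lemma smulLat_smulLat (c d : K) (L : Submodule ℤ K) :
    smulLat c (smulLat d L) = smulLat (c * d) L := by
  ext z
  simp [smulLat]

lemma smulLat_neg_one (L : Submodule ℤ K) : smulLat (-1) L = L := by
  ext z
  simp [smulLat, neg_eq_iff_eq_neg]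

/-- The group of units of `K` mapping the lattice `L` onto itself. -/
def latStabilizer (L : Submodule ℤ K) : Subgroup Kˣ where
  carrier := {c | smulLat (c : K) L = L}
  one_mem' := smulLat_one L
  mul_mem' {c d} hc hd := by
    simp only [Set.mem_ofPred_eq] at hc hd ⊢
    rw [Units.val_mul, ← smulLat_smulLat, hd, hc]
  inv_mem' {c} hc := by
    simp only [Set.mem_ofPred_eq] at hc ⊢
    nth_rw 1 [← hc]
    rw [smulLat_smulLat, ← Units.val_mul, inv_mul_cancel, Units.val_one, smulLat_one]

lemma mem_latStabilizer {L : Submodule ℤ K} {c : Kˣ} :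
    c ∈ latStabilizer L ↔ smulLat (c : K) L = L := Iff.rfl

lemma neg_mem_latStabilizer {L : Submodule ℤ K} {c : Kˣ} (hc : c ∈ latStabilizer L) :
    -c ∈ latStabilizer L := by
  rw [mem_latStabilizer] at hc ⊢
  rw [Units.val_neg, ← mul_neg_one, ← smulLat_smulLat, smulLat_neg_one, hc]

lemma smulLat_le_of_act_eq {g : Matrix (Fin 2) (Fin 2) ℚ} (hg : g ∈ GLZset) {y : Fin 2 → K}
    {c : K} (h : act g y = rsc y c) : smulLat c (lat y) ≤ lat y := by
  rw [smulLat_le_iff]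
  intro i
  obtain ⟨a, ha⟩ := hg.1 i 0
  obtain ⟨b, hb⟩ := hg.1 i 1
  refine mem_lat.mpr ⟨a, b, ?_⟩
  have := congrFun h i
  rw [act_apply, ha, hb] at this
  simpa [rsc] using this

lemma mem_latStabilizer_of_act_eq {g : Matrix (Fin 2) (Fin 2) ℚ} (hg : g ∈ GLZset)
    {y : Fin 2 → K} {c : Kˣ} (h : act g y = rsc y (c : K)) : c ∈ latStabilizer (lat y) := by
  have hinv : act g⁻¹ y = rsc y ((c⁻¹ : Kˣ) : K) := by
    simpa using act_zpow (isUnit_det_of_mem_GLZset hg) h (-1)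
  refine le_antisymm (smulLat_le_of_act_eq hg h) ?_
  have := Submodule.map_mono (f := LinearMap.mulLeft ℤ (c : K))
    (smulLat_le_of_act_eq (inv_mem_GLZset hg) hinv)
  change smulLat _ (smulLat _ _) ≤ smulLat _ _ at this
  rwa [smulLat_smulLat, ← Units.val_mul, mul_inv_cancel, Units.val_one, smulLat_one] at this

lemma exists_int_matrix_of_smulLat_le {y : Fin 2 → K} {c : K}
    (h : smulLat c (lat y) ≤ lat y) :
    ∃ A : Matrix (Fin 2) (Fin 2) ℤ, act (A.map (Int.castRingHom ℚ)) y = rsc y c := by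
  rw [smulLat_le_iff] at h
  choose a b hab using fun i => mem_lat.mp (h i)
  refine ⟨Matrix.of fun i => ![a i, b i], ?_⟩
  funext i
  simpa [act_apply, rsc] using hab i

lemma exists_act_eq_of_mem_latStabilizer {y : Fin 2 → K} (hy : y ∈ Y K) {c : Kˣ}
    (hc : c ∈ latStabilizer (lat y)) : ∃ g ∈ GLZset, act g y = rsc y (c : K) := by
  obtain ⟨A, hA⟩ := exists_int_matrix_of_smulLat_le (mem_latStabilizer.mp hc).le
  obtain ⟨B, hB⟩ := exists_int_matrix_of_smulLat_le (mem_latStabilizer.mp (inv_mem hc)).le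
  refine ⟨_, mem_GLZset_iff.mpr ⟨A, ?_, rfl⟩, hA⟩
  have hAB : A.map (Int.castRingHom ℚ) * B.map (Int.castRingHom ℚ) = 1 := by
    refine act_injective hy ?_
    rw [act_mul, hB, act_rsc, hA, rsc_rsc, ← Units.val_mul, mul_inv_cancel, Units.val_one,
      rsc_one, act_one]
  have hAB' : A * B = 1 := by
    rw [← Matrix.map_mul] at hAB
    refine Matrix.map_injective (Int.castRingHom ℚ).injective_int (hAB.trans ?_)
    simp
  exact Matrix.isUnit_det_of_right_inverse hAB'

lemma isIntegral_of_mem_latStabilizer {y : Fin 2 → K} (hy : y ∈ Y K) {c : Kˣ}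
    (hc : c ∈ latStabilizer (lat y)) : IsIntegral ℤ (c : K) := by
  refine isIntegral_of_smul_mem_submodule (lat y) ?_ ?_ (c : K) ?_
  · intro hbot
    refine hy.1 ?_
    have := mem_lat_apply y 1
    rwa [hbot, Submodule.mem_bot] at this
  · exact Submodule.fg_span (by simp)
  · intro z hz
    have := Submodule.mem_map_of_mem (f := LinearMap.mulLeft ℤ (c : K)) hz
    rw [← mem_latStabilizer.mp hc]
    exact this

/-- Every unit of `K` stabilizing the lattice of an element of `Y` comes from `𝒪ˣ`. -/
lemma exists_unitToK_eq_of_mem_latStabilizer {y : Fin 2 → K} (hy : y ∈ Y K) {c : Kˣ}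
    (hc : c ∈ latStabilizer (lat y)) : ∃ u : (𝓞 K)ˣ, unitToK K u = c := by
  refine ⟨⟨⟨c, isIntegral_of_mem_latStabilizer hy hc⟩,
    ⟨(c⁻¹ : Kˣ), isIntegral_of_mem_latStabilizer hy (inv_mem hc)⟩, ?_, ?_⟩, ?_⟩
  · exact RingOfIntegers.ext c.mul_inv
  · exact RingOfIntegers.ext c.inv_mul
  · ext; rfl

end Lattice

/-- The subgroup generated by `-1` and a subgroup `H` of the units of a commutative ring. -/
def adjoinNegOne {R : Type*} [CommRing R] (H : Subgroup Rˣ) : Subgroup Rˣ where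
  carrier := {c | c ∈ H ∨ -c ∈ H}
  one_mem' := Or.inl (one_mem H)
  mul_mem' {c d} hc hd := by
    rcases hc with hc | hc <;> rcases hd with hd | hd
    · exact Or.inl (mul_mem hc hd)
    · exact Or.inr (by simpa using mul_mem hc hd)
    · exact Or.inr (by simpa using mul_mem hc hd)
    · exact Or.inl (by simpa using mul_mem hc hd)
  inv_mem' {c} hc := by
    rcases hc with hc | hc
    · exact Or.inl (inv_mem hc)
    · exact Or.inr (by simpa using inv_mem hc)

/-- If `m` is the least positive exponent with `e ^ m ∈ G`, every exponent `n` with `e ^ n ∈ G`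
is a multiple of `m`. -/
lemma dvd_of_zpow_mem_of_isLeast {M : Type*} [Group M] {G : Subgroup M} {e : M} {m : ℕ}
    (hm : IsLeast {j : ℕ | 0 < j ∧ e ^ j ∈ G} m) {n : ℤ} (hn : e ^ n ∈ G) : (m : ℤ) ∣ n := by
  obtain ⟨⟨hpos, hmem⟩, hleast⟩ := hm
  have hm0 : (m : ℤ) ≠ 0 := by exact_mod_cast hpos.ne'
  obtain ⟨r, hr⟩ := Int.eq_ofNat_of_zero_le (Int.emod_nonneg n hm0)
  have hrlt : r < m := by
    have := Int.emod_lt_of_pos n (by exact_mod_cast hpos : (0 : ℤ) < m)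
    omega
  have hrmem : e ^ r ∈ G := by
    have hdecomp : e ^ r = e ^ n * ((e ^ m) ^ (n / m))⁻¹ := by
      rw [← _root_.zpow_natCast e r, ← hr, ← _root_.zpow_natCast e m, ← _root_.zpow_mul,
        ← _root_.zpow_neg, ← _root_.zpow_add, Int.emod_def, sub_eq_add_neg]
    rw [hdecomp]
    exact mul_mem hn (inv_mem (zpow_mem hmem _))
  rcases Nat.eq_zero_or_pos r with h0 | h0
  · exact Int.dvd_of_emod_eq_zero (by simp [hr, h0])
  · exact absurd (hleast ⟨h0, hrmem⟩) (not_le.mpr hrlt)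

/-- STATEMENT 2.  Let `H` be a unit-cofinite subgroup of `K^×` and let `x ∈ Y/H` be
represented by `y ∈ Y`.  Let `m` be the smallest positive integer such that
`ε^m Λ_y = Λ_y` and at least one of `ε^m, -ε^m` lies in `H`, and let `δ = ±ε^m` be chosen
in `H` (with `δ = ε^m` if both lie in `H`).  Then there is a unique `g ∈ Γ_x` with
`g·y = y·δ`; the quotient `Γ_x/(Γ_x ∩ {±I})` is cyclic, generated by the image of `g`:
every element of `Γ_x` equals `±g^k` for some integer `k`. -/
theorem statement_2 (K : Type) [Field K] [NumberField K]
    (hdeg : Module.finrank ℚ K = 2) (hreal : Nonempty (K →+* ℝ))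
    (ω : 𝓞 K) (hω : Algebra.adjoin ℤ {ω} = ⊤)
    (ε : (𝓞 K)ˣ) (hε : ∀ u : (𝓞 K)ˣ, ∃ n : ℤ, u = ε ^ n ∨ u = -ε ^ n)
    (H : Subgroup Kˣ)
    (hcofin : (H.comap (Units.map (algebraMap (𝓞 K) K).toMonoidHom)).FiniteIndex)
    (y : Ysub K) (m : ℕ)
    (hm : IsLeast {j : ℕ | 0 < j ∧
        smulLat ((algebraMap (𝓞 K) K (ε : 𝓞 K)) ^ j) (lat y.1) = lat y.1 ∧
        (unitToK K ε ^ j ∈ H ∨ -(unitToK K ε ^ j) ∈ H)} m)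
    (δ : Kˣ) (hδH : δ ∈ H) (hδval : δ = unitToK K ε ^ m ∨ δ = -(unitToK K ε ^ m))
    (hδchoice : unitToK K ε ^ m ∈ H → δ = unitToK K ε ^ m) :
    ∃ g : Matrix (Fin 2) (Fin 2) ℚ,
      (g ∈ stabSet K H y ∧ act g y.1 = rsc y.1 (δ : K)) ∧
      (∀ g' ∈ stabSet K H y, act g' y.1 = rsc y.1 (δ : K) → g' = g) ∧
      (∀ η ∈ stabSet K H y, ∃ k : ℤ, η = g ^ k ∨ η = -(g ^ k)) := by
  have hmG : IsLeast {j : ℕ | 0 < j ∧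
      unitToK K ε ^ j ∈ latStabilizer (lat y.1) ⊓ adjoinNegOne H} m := by
    convert hm using 4
    rw [Subgroup.mem_inf, mem_latStabilizer, Units.val_pow_eq_pow_val]
    rfl
  have hemS : unitToK K ε ^ m ∈ latStabilizer (lat y.1) := hmG.1.2.1
  have hδS : δ ∈ latStabilizer (lat y.1) := by
    rcases hδval with rfl | rfl
    · exact hemS
    · exact neg_mem_latStabilizer hemS
  obtain ⟨g, hgGL, hg⟩ := exists_act_eq_of_mem_latStabilizer y.2 hδS
  refine ⟨g, ⟨⟨hgGL, δ, hδH, hg⟩, hg⟩, fun g' _ hg' => act_injective y.2 (hg'.trans hg.symm), ?_⟩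
  rintro η ⟨hηGL, c, hcH, hη⟩
  have hcS := mem_latStabilizer_of_act_eq hηGL hη
  obtain ⟨u, hu⟩ := exists_unitToK_eq_of_mem_latStabilizer y.2 hcS
  have hcε : ∃ n : ℤ, c = unitToK K ε ^ n ∨ c = -(unitToK K ε ^ n) := by
    obtain ⟨n, h | h⟩ := hε u
    · exact ⟨n, Or.inl (by rw [← hu, h]; exact map_zpow _ _ _)⟩
    · refine ⟨n, Or.inr ?_⟩
      rw [← hu, h, unitToK, unitToK, ← map_zpow]
      ext
      simp
  obtain ⟨n, hn⟩ := hcε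
  have hnG : unitToK K ε ^ n ∈ latStabilizer (lat y.1) ⊓ adjoinNegOne H := by
    rcases hn with rfl | rfl
    · exact ⟨hcS, Or.inl hcH⟩
    · exact ⟨by simpa using neg_mem_latStabilizer hcS, Or.inr hcH⟩
  obtain ⟨k, rfl⟩ := dvd_of_zpow_mem_of_isLeast hmG hnG
  have hδk : unitToK K ε ^ ((m : ℤ) * k) = δ ^ k ∨ unitToK K ε ^ ((m : ℤ) * k) = -δ ^ k := by
    rw [_root_.zpow_mul, _root_.zpow_natCast]
    rcases hδval with h | h
    · exact Or.inl (by rw [h])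
    · rw [h]
      rcases Int.even_or_odd k with hk | hk
      · exact Or.inl (hk.neg_zpow _).symm
      · exact Or.inr (by rw [hk.neg_zpow, neg_neg])
  have hc : c = δ ^ k ∨ c = -δ ^ k := by
    rcases hn with rfl | rfl <;> rcases hδk with h | h <;> simp [h]
  have hgk := act_zpow (isUnit_det_of_mem_GLZset hgGL) hg k
  refine ⟨k, hc.imp (fun h => ?_) fun h => ?_⟩
  · exact act_injective y.2 (by rw [hη, hgk, h])
  · exact act_injective y.2 (by rw [hη, act_neg, hgk, h, rsc_rsc, mul_neg_one, Units.val_neg])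

end AD
end
end

section
/- If α ∈ K_{S₀}, then α is relatively prime to pdN: every prime ideal of 𝒪 occurring with nonzero exponent in the prime factorization of the fractional ideal α𝒪 is coprime to the ideal pdN·𝒪. -/
open scoped Pointwise Classical
open Matrix NumberField

noncomputable section

namespace AD

/-- Reduction of a rational number modulo `n` (this is the genuine reduction whenever the
denominator is coprime to `n`). -/
def ratRed (n : ℕ) (r : ℚ) : ZMod n := (r.num : ZMod n) * ((r.den : ZMod n))⁻¹

/-- `S₀(n)`: the largest subgroup of `GL(2,ℚ)` that can be mapped modulo `n` to
`GL(2,ℤ/nℤ)`, i.e. the invertible rational matrices which are `n`-integral and whose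
reduction modulo `n` is invertible. -/
def S0set (n : ℕ) : Set (Matrix (Fin 2) (Fin 2) ℚ) :=
  {g | IsUnit g.det ∧ (∀ i j, Nat.Coprime (g i j).den n) ∧ IsUnit (g.map (ratRed n)).det}

/-- `S = S(m) ∩ S₀(n)`: the elements of `S₀(n)` reducing to the identity modulo `m`. -/
def Sset (n m : ℕ) : Set (Matrix (Fin 2) (Fin 2) ℚ) :=
  {g | g ∈ S0set n ∧ g.map (ratRed m) = 1}

/-- `p`: the characteristic of `𝔽` when it is positive, and `1` when `char 𝔽 = 0`. -/
def pOf (𝔽 : Type*) [Field 𝔽] : ℕ := if ringChar 𝔽 = 0 then 1 else ringChar 𝔽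

/-- The quantity `p·d·N` where `d` is (the absolute value of) the discriminant of `K`. -/
def pdN (𝔽 : Type*) [Field 𝔽] (K : Type*) [Field K] [NumberField K] (N : ℕ) : ℕ :=
  pOf 𝔽 * (NumberField.discr K).natAbs * N

/-- `K_{S₀}` (for the level `n`): the set of `c ∈ K^×` such that `r_ω̄(c) ∈ S₀(n)`, where
`r_ω̄(c)` is the unique rational matrix with `r_ω̄(c)·ω̄ = ω̄·c` and `ω̄ = (ω,1)ᵀ`. -/
def KS0set (K : Type*) [Field K] [NumberField K] (n : ℕ) (ω : K) : Set K :=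
  {c | ∃ g ∈ S0set n, act g ![ω, 1] = rsc ![ω, 1] c}

/-- `K_S`: the set of `c ∈ K^×` with `r_ω̄(c) ∈ S = S(m) ∩ S₀(n)`. -/
def KSset (K : Type*) [Field K] [NumberField K] (n m : ℕ) (ω : K) : Set K :=
  {c | ∃ g ∈ Sset n m, act g ![ω, 1] = rsc ![ω, 1] c}

/-- The rational prime `ℓ` is inert in `K`: `ℓ𝒪` is a prime ideal of `𝒪`. -/
def IsInert (K : Type*) [Field K] [NumberField K] (ℓ : ℕ) : Prop :=
  ℓ.Prime ∧ (Ideal.span {(ℓ : 𝓞 K)}).IsPrime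

/-- The total multiplicity of the inert primes in the factorization of `n`. -/
def inertMultNat (K : Type*) [Field K] [NumberField K] (n : ℕ) : ℕ :=
  n.factorization.sum fun ℓ e => if IsInert K ℓ then e else 0

/-- The value `q(rI) = θ(r)` of the quadratic Dirichlet character `θ` cutting out the real
quadratic field `K` (characterized by `θ(-1) = 1`, `θ(ℓ) = 1` for `ℓ` split, `θ(ℓ) = -1`
for `ℓ` inert, extended multiplicatively), taken in `𝔽`. -/
def qRat (K : Type*) [Field K] [NumberField K] (𝔽 : Type*) [Field 𝔽] (r : ℚ) : 𝔽 :=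
  (-1) ^ (inertMultNat K r.num.natAbs + inertMultNat K r.den)

/-- The number (with multiplicity) of inert prime ideal factors of the ideal `(x)`. -/
def inertCount (K : Type*) [Field K] [NumberField K] (x : 𝓞 K) : ℕ :=
  Multiset.countP (fun P => ∃ ℓ : ℕ, IsInert K ℓ ∧ P = Ideal.span {(ℓ : 𝓞 K)})
    (UniqueFactorizationMonoid.factors (Ideal.span {x}))

/-- `q^*(α)`: the product, over the inert prime ideals `(ℓ)` occurring in the prime
factorization of the fractional ideal `α𝒪`, of `q(ℓI) = -1` raised to the corresponding
exponent. -/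
def qstar (K : Type*) [Field K] [NumberField K] (𝔽 : Type*) [Field 𝔽] (α : K) : 𝔽 :=
  (-1) ^ (inertCount K (IsLocalization.sec (nonZeroDivisors (𝓞 K)) α).1 +
      inertCount K ((IsLocalization.sec (nonZeroDivisors (𝓞 K)) α).2 : 𝓞 K))

/-- `K_{S,q}`: the kernel of `q^*` restricted to `K_S`. -/
def KSqSet (K : Type*) [Field K] [NumberField K] (𝔽 : Type*) [Field 𝔽] (n m : ℕ)
    (ω : K) : Set K :=
  {c | c ∈ KSset K n m ω ∧ qstar K 𝔽 c = 1}

/-- The scalars of the elements of `Z`: the matrix `rI` belongs to `Z` iff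
`r ∈ ℚ^× ∩ K_{S₀}`. -/
def Zscal (K : Type*) [Field K] [NumberField K] (n : ℕ) (ω : K) : Set ℚ :=
  {r | r ≠ 0 ∧ algebraMap ℚ K r ∈ KS0set K n ω}

end AD
namespace AD

/-- A reduced fraction with denominator prime to `n` reduces as expected after clearing a
multiple `m` of its denominator. -/
lemma ratRed_mul_of_mul_eq {n m : ℕ} {r : ℚ} {x : ℤ} (hr : r.den.Coprime n)
    (hx : r * m = x) : ratRed n r * (m : ZMod n) = (x : ZMod n) := by
  have hd : ((r.den : ZMod n))⁻¹ * (r.den : ZMod n) = 1 := by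
    rw [mul_comm]
    exact ZMod.coe_mul_inv_eq_one _ hr
  have hZ : r.num * (m : ℤ) = x * (r.den : ℤ) := by
    have hden : (r.den : ℚ) ≠ 0 := by exact_mod_cast r.den_nz
    have hq : (r.num : ℚ) * m = x * r.den := by
      rw [← hx, ← Rat.mul_den_eq_num r]
      ring
    exact_mod_cast hq
  have hZ' : (r.num : ZMod n) * (m : ZMod n) = (x : ZMod n) * (r.den : ZMod n) := by
    exact_mod_cast congrArg (Int.cast : ℤ → ZMod n) hZ
  unfold ratRed
  linear_combination ((r.den : ZMod n))⁻¹ * hZ' + (x : ZMod n) * hd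

/-- A matrix in `S₀(n)` is, up to a positive integer prime to `n`, an integral matrix whose
determinant is prime to `n`. -/
lemma exists_integral_multiple_of_mem_S0set {n : ℕ} {g : Matrix (Fin 2) (Fin 2) ℚ}
    (hg : g ∈ S0set n) :
    ∃ (m : ℕ) (G : Matrix (Fin 2) (Fin 2) ℤ), m ≠ 0 ∧ m.Coprime n ∧
      (∀ i j, g i j * m = G i j) ∧ IsCoprime G.det (n : ℤ) := by
  obtain ⟨-, hden, hunit⟩ := hg
  have hmul : ∀ i j, ∃ x : ℤ, g i j * ((∏ i, ∏ j, (g i j).den : ℕ) : ℚ) = x := by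
    intro i j
    obtain ⟨k, hk⟩ : (g i j).den ∣ ∏ i, ∏ j, (g i j).den :=
      (Finset.dvd_prod_of_mem (fun j => (g i j).den) (Finset.mem_univ j)).trans
        (Finset.dvd_prod_of_mem (fun i => ∏ j, (g i j).den) (Finset.mem_univ i))
    refine ⟨(g i j).num * k, ?_⟩
    rw [hk]
    push_cast
    rw [← mul_assoc, Rat.mul_den_eq_num]
  have hm : (∏ i, ∏ j, (g i j).den).Coprime n :=
    Nat.Coprime.prod_left fun i _ => Nat.Coprime.prod_left fun j _ => hden i j
  have hm0 : (∏ i, ∏ j, (g i j).den) ≠ 0 :=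
    Finset.prod_ne_zero_iff.2 fun i _ => Finset.prod_ne_zero_iff.2 fun j _ => (g i j).den_nz
  generalize (∏ i, ∏ j, (g i j).den) = m at hmul hm hm0
  choose G hG using hmul
  refine ⟨m, Matrix.of G, hm0, hm, hG, ?_⟩
  have hmunit : IsUnit (m : ZMod n) := (ZMod.isUnit_iff_coprime m n).2 hm
  have hdet : (((Matrix.of G).det : ℤ) : ZMod n) = (g.map (ratRed n)).det * (m : ZMod n) ^ 2 := by
    have h := fun i j => ratRed_mul_of_mul_eq (hden i j) (hG i j)
    rw [Matrix.det_fin_two, Matrix.det_fin_two]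
    push_cast
    simp only [← h, Matrix.map_apply, Matrix.of_apply]
    ring
  have hdetunit : IsUnit (((Matrix.of G).det : ℤ) : ZMod n) := by
    rw [hdet]
    exact hunit.mul (hmunit.pow 2)
  exact (ZMod.coe_int_isUnit_iff_isCoprime _ _).1 hdetunit |>.symm

/-- The trace–determinant relation for an eigenvalue of an integral `2 × 2` matrix with
eigenvector `(w, 1)ᵀ`. -/
lemma det_eq_eigenvalue_mul {R : Type*} [CommRing R] (G : Matrix (Fin 2) (Fin 2) ℤ) {w A : R}
    (h0 : (G 0 0 : R) * w + G 0 1 = w * A) (h1 : (G 1 0 : R) * w + G 1 1 = A) :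
    ((G.det : ℤ) : R) = A * ((G 0 0 : R) + G 1 1 - A) := by
  rw [Matrix.det_fin_two]
  push_cast
  linear_combination ((G 0 0 : R) - A) * h1 - (G 1 0 : R) * h0

/-- An element outside an ideal contributes nothing to the multiplicity of that ideal. -/
lemma count_factors_span_mul_of_notMem {R : Type*} [CommRing R] [IsDedekindDomain R]
    {P : Ideal R} {x y : R} (hx : x ∉ P) (hy : y ≠ 0) :
    Multiset.count P (UniqueFactorizationMonoid.factors (Ideal.span {x * y})) =
      Multiset.count P (UniqueFactorizationMonoid.factors (Ideal.span {y})) := by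
  have hx0 : x ≠ 0 := fun h => hx (h ▸ P.zero_mem)
  have hrel := UniqueFactorizationMonoid.factors_mul
    (x := Ideal.span {x}) (y := Ideal.span {y})
    (mt Ideal.span_singleton_eq_bot.1 hx0) (mt Ideal.span_singleton_eq_bot.1 hy)
  rw [associated_eq_eq, Multiset.rel_eq, Ideal.span_singleton_mul_span_singleton] at hrel
  rw [hrel, Multiset.count_add, Nat.add_eq_right, Multiset.count_eq_zero]
  intro hmem
  have hdvd := UniqueFactorizationMonoid.dvd_of_mem_factors hmem
  exact hx ((Ideal.span_singleton_le_iff_mem P).1 (Ideal.dvd_iff_le.1 hdvd))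

/-- STATEMENT 5.  If `α ∈ K_{S₀}`, then `α` is relatively prime to `pdN`: every prime
ideal of `𝒪` occurring with nonzero exponent in the prime factorization of the fractional
ideal `α𝒪` is coprime to the ideal `pdN·𝒪`.  (Writing `α = a/b` with `a, b ∈ 𝒪`, `b ≠ 0`,
the exponent of a prime `P` in `α𝒪` is the difference of its multiplicities in the
factorizations of `(a)` and `(b)`.) -/
theorem statement_5 (K : Type) [Field K] [NumberField K]
    (hdeg : Module.finrank ℚ K = 2) (hreal : Nonempty (K →+* ℝ))
    (ω : 𝓞 K) (hω : Algebra.adjoin ℤ {ω} = ⊤)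
    (𝔽 : Type) [Field 𝔽] (hchar : ringChar 𝔽 ≠ 2)
    (N Mlev : ℕ) (hN : 0 < N) (hMlev : 3 ≤ Mlev) (hdvd : Mlev ∣ pdN 𝔽 K N)
    (α : K) (hα : α ∈ KS0set K (pdN 𝔽 K N) (algebraMap (𝓞 K) K ω)) :
    ∀ a b : 𝓞 K, b ≠ 0 → algebraMap (𝓞 K) K a = α * algebraMap (𝓞 K) K b →
      ∀ P : Ideal (𝓞 K), P.IsPrime →
        Multiset.count P (UniqueFactorizationMonoid.factors (Ideal.span {a})) ≠
          Multiset.count P (UniqueFactorizationMonoid.factors (Ideal.span {b})) →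
        IsCoprime P (Ideal.span {(pdN 𝔽 K N : 𝓞 K)}) := by
  intro a b hb hab P hP hcount
  by_contra hcop
  obtain ⟨g, hg, hact⟩ := hα
  have hP0 : P ≠ ⊥ := by
    rintro rfl
    refine hcount ?_
    have hnot : ∀ I : Ideal (𝓞 K), (⊥ : Ideal (𝓞 K)) ∉ UniqueFactorizationMonoid.factors I :=
      fun I h => (UniqueFactorizationMonoid.irreducible_of_factor _ h).ne_zero rfl
    rw [Multiset.count_eq_zero.2 (hnot _), Multiset.count_eq_zero.2 (hnot _)]
  have hPmax : P.IsMaximal := hP.isMaximal hP0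
  have hnP : (pdN 𝔽 K N : 𝓞 K) ∈ P := by
    by_contra hn
    refine hcop (Ideal.isCoprime_iff_sup_eq.2 (hPmax.1.2 _ (lt_of_le_of_ne le_sup_left ?_)))
    intro h
    refine hn ?_
    rw [h]
    exact Ideal.mem_sup_right (Ideal.mem_span_singleton_self _)
  obtain ⟨m, G, hm0, hm, hG, hdet⟩ := exists_integral_multiple_of_mem_S0set hg
  have notMem_of_coprime : ∀ z : ℤ, IsCoprime z (pdN 𝔽 K N : ℤ) → (z : 𝓞 K) ∉ P := by
    rintro z ⟨u, v, huv⟩ hz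
    refine hP.ne_top ((Ideal.eq_top_iff_one P).2 ?_)
    have h1 : (u : 𝓞 K) * z + v * (pdN 𝔽 K N : 𝓞 K) = 1 := by
      exact_mod_cast congrArg (Int.cast : ℤ → 𝓞 K) huv
    rw [← h1]
    exact P.add_mem (P.mul_mem_left _ hz) (P.mul_mem_left _ hnP)
  have hmP : (m : 𝓞 K) ∉ P := by
    have := notMem_of_coprime m (Nat.isCoprime_iff_coprime.2 hm)
    exact_mod_cast this
  set A : 𝓞 K := (G 1 0 : 𝓞 K) * ω + G 1 1 with hA
  have hGK : ∀ i j, algebraMap ℚ K (g i j) * (m : K) = (G i j : K) := by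
    intro i j
    have h := congrArg (algebraMap ℚ K) (hG i j)
    simpa using h
  have e0 := congrFun hact 0
  have e1 := congrFun hact 1
  simp only [act, rsc, Matrix.mulVec, dotProduct, Fin.sum_univ_two, Matrix.map_apply,
    Matrix.cons_val_zero, Matrix.cons_val_one, mul_one, one_mul] at e0 e1
  have hAα : algebraMap (𝓞 K) K A = α * m := by
    rw [hA]
    simp only [map_add, map_mul, map_intCast, ← hGK]
    linear_combination (m : K) * e1
  have hinj := FaithfulSMul.algebraMap_injective (𝓞 K) K
  have hω0 : (G 0 0 : 𝓞 K) * ω + G 0 1 = ω * A := by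
    apply hinj
    rw [map_mul _ ω A, hAα]
    simp only [map_add, map_mul, map_intCast, ← hGK]
    linear_combination (m : K) * e0
  have hAP : A ∉ P := by
    intro h
    refine notMem_of_coprime _ hdet ?_
    rw [det_eq_eigenvalue_mul G hω0 hA.symm]
    exact P.mul_mem_right _ h
  have hmul : (m : 𝓞 K) * a = A * b := by
    apply hinj
    rw [map_mul, map_mul, hab, hAα, map_natCast]
    ring
  have ha : a ≠ 0 := by
    rintro rfl
    rw [mul_zero] at hmul
    exact mul_ne_zero (fun h : A = 0 => hAP (h.symm ▸ P.zero_mem)) hb hmul.symm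
  refine hcount ?_
  rw [← count_factors_span_mul_of_notMem hmP ha, hmul, count_factors_span_mul_of_notMem hAP hb]

end AD
end
end

section
/- Let ζ = rI ∈ Z with r ∈ ℚ^× ∩ K_{S₀}, let α ∈ K_{S,q}, and let y ∈ Y. If ζ·r_y(α) ∈ GL(2,ℤ), then q(ζ) = 1. -/
open scoped Pointwise Classical
open Matrix NumberField

noncomputable section

namespace AD

open UniqueFactorizationMonoid in
theorem inertCount_mul {K : Type*} [Field K] [NumberField K] {x y : 𝓞 K} (hx : x ≠ 0)
    (hy : y ≠ 0) : inertCount K (x * y) = inertCount K x + inertCount K y := by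
  have hx' : Ideal.span {x} ≠ 0 := by simpa using hx
  have hy' : Ideal.span {y} ≠ 0 := by simpa using hy
  have h : factors (Ideal.span {x} * Ideal.span {y}) =
      factors (Ideal.span {x}) + factors (Ideal.span {y}) := by
    have h := factors_mul hx' hy'
    rwa [associated_eq_eq, Multiset.rel_eq] at h
  unfold inertCount
  rw [← Ideal.span_singleton_mul_span_singleton, h, Multiset.countP_add]

theorem inertCount_of_isUnit {K : Type*} [Field K] [NumberField K] {x : 𝓞 K} (hx : IsUnit x) :
    inertCount K x = 0 := by
  unfold inertCount
  rw [Ideal.span_singleton_eq_top.mpr hx, ← Ideal.one_eq_top,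
    UniqueFactorizationMonoid.factors_one, Multiset.countP_zero]

theorem inertCount_prime {K : Type*} [Field K] [NumberField K] {ℓ : ℕ} (hℓ : ℓ.Prime) :
    inertCount K (ℓ : 𝓞 K) = if IsInert K ℓ then 1 else 0 := by
  have h0 : Ideal.span {(ℓ : 𝓞 K)} ≠ 0 := by simpa using hℓ.ne_zero
  unfold inertCount
  split_ifs with h
  · have hirr : Irreducible (Ideal.span {(ℓ : 𝓞 K)}) := (Ideal.prime_of_isPrime h0 h.2).irreducible
    have hfac : UniqueFactorizationMonoid.factors (Ideal.span {(ℓ : 𝓞 K)}) =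
        {Ideal.span {(ℓ : 𝓞 K)}} := by
      have hrel := UniqueFactorizationMonoid.factors_unique
        (g := {Ideal.span {(ℓ : 𝓞 K)}}) UniqueFactorizationMonoid.irreducible_of_factor
        (by simpa using hirr) (by simpa using UniqueFactorizationMonoid.factors_prod h0)
      rwa [associated_eq_eq, Multiset.rel_eq] at hrel
    rw [hfac]
    exact Multiset.countP_eq_card.mpr (by simpa using ⟨ℓ, h, rfl⟩)
  · rw [Multiset.countP_eq_zero]
    rintro P hP ⟨q, hq, rfl⟩
    refine h ?_
    suffices q = ℓ from this ▸ hq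
    by_contra hne
    have hmem : (ℓ : 𝓞 K) ∈ Ideal.span {(q : 𝓞 K)} :=
      Ideal.dvd_span_singleton.mp (UniqueFactorizationMonoid.dvd_of_mem_factors hP)
    have hcop : IsCoprime (q : 𝓞 K) (ℓ : 𝓞 K) :=
      ((Nat.coprime_primes hq.1 hℓ).mpr hne).cast
    obtain ⟨u, v, huv⟩ := hcop
    refine hq.2.ne_top ((Ideal.eq_top_iff_one _).mpr ?_)
    rw [← huv]
    exact Ideal.add_mem _ (Ideal.mul_mem_left _ _ (Ideal.mem_span_singleton_self _))
      (Ideal.mul_mem_left _ _ hmem)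

theorem inertMultNat_mul (K : Type*) [Field K] [NumberField K] {a b : ℕ} (ha : a ≠ 0)
    (hb : b ≠ 0) : inertMultNat K (a * b) = inertMultNat K a + inertMultNat K b := by
  unfold inertMultNat
  rw [Nat.factorization_mul ha hb, Finsupp.sum_add_index']
  · simp
  · intro ℓ m n
    split_ifs <;> rfl

theorem inertMultNat_prime (K : Type*) [Field K] [NumberField K] {ℓ : ℕ} (hℓ : ℓ.Prime) :
    inertMultNat K ℓ = if IsInert K ℓ then 1 else 0 := by
  unfold inertMultNat
  rw [hℓ.factorization, Finsupp.sum_single_index (by simp)]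

theorem inertCount_natCast (K : Type*) [Field K] [NumberField K] {n : ℕ} (hn : n ≠ 0) :
    inertCount K (n : 𝓞 K) = inertMultNat K n := by
  induction n using Nat.recOnMul with
  | zero => exact absurd rfl hn
  | one => rw [Nat.cast_one, inertCount_of_isUnit isUnit_one]; simp [inertMultNat]
  | prime p hp => rw [inertCount_prime hp, inertMultNat_prime K hp]
  | mul a b iha ihb =>
    obtain ⟨ha, hb⟩ := mul_ne_zero_iff.mp hn
    rw [Nat.cast_mul, inertCount_mul (by exact_mod_cast ha) (by exact_mod_cast hb), iha ha,
      ihb hb, inertMultNat_mul K ha hb]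

theorem inertCount_intCast (K : Type*) [Field K] [NumberField K] {n : ℤ} (hn : n ≠ 0) :
    inertCount K (n : 𝓞 K) = inertMultNat K n.natAbs := by
  rw [← inertCount_natCast K (Int.natAbs_ne_zero.mpr hn)]
  unfold inertCount
  congr 2
  rw [Ideal.span_singleton_eq_span_singleton]
  rcases Int.natAbs_eq n with h | h
  · rw [← Int.cast_natCast n.natAbs, ← h]
  · rw [← Int.cast_natCast n.natAbs, show (n.natAbs : ℤ) = -n by lia,
      Int.cast_neg]
    exact (Associated.refl _).neg_right

/-- An eigenvalue of an element of `GL(2,ℤ)` on a nonzero vector of `K²` is a unit of `𝓞 K`. -/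
theorem exists_unit_of_act_eq_rsc {K : Type*} [Field K] [NumberField K]
    {A : Matrix (Fin 2) (Fin 2) ℚ} (hA : A ∈ GLZset) {y : Fin 2 → K} (hy : y 1 ≠ 0) {c : K}
    (h : act A y = rsc y c) : ∃ u : (𝓞 K)ˣ, algebraMap (𝓞 K) K u = c := by
  obtain ⟨hint, hdet⟩ := hA
  choose B hB using hint
  have h0 : (B 0 0 : K) * y 0 + B 0 1 * y 1 = y 0 * c := by
    simpa [act, rsc, Matrix.mulVec, dotProduct, Fin.sum_univ_two, hB] using congrFun h 0
  have h1 : (B 1 0 : K) * y 0 + B 1 1 * y 1 = y 1 * c := by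
    simpa [act, rsc, Matrix.mulVec, dotProduct, Fin.sum_univ_two, hB] using congrFun h 1
  have hchar : c * ((B 0 0 + B 1 1 : ℤ) - c) = ((B 0 0 * B 1 1 - B 0 1 * B 1 0 : ℤ) : K) := by
    refine mul_right_cancel₀ hy ?_
    push_cast
    linear_combination (B 1 0 : K) * h0 + (c - B 0 0) * h1
  set t : ℤ := B 0 0 + B 1 1
  set D : ℤ := B 0 0 * B 1 1 - B 0 1 * B 1 0 with hDdef
  have hD : D * D = 1 := by
    have hAD : A.det = (D : ℚ) := by rw [Matrix.det_fin_two]; simp [hB, hDdef]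
    rw [hAD] at hdet
    rcases hdet with h | h
    · have : D = 1 := by exact_mod_cast h
      rw [this]; rfl
    · have : D = -1 := by exact_mod_cast h
      rw [this]; rfl
  have hc : IsIntegral ℤ c := by
    refine ⟨Polynomial.X ^ 2 - Polynomial.C t * Polynomial.X + Polynomial.C D, ?_, ?_⟩
    · monicity!
    · rw [← Polynomial.aeval_def]
      simp only [map_add, map_sub, map_mul, map_pow, Polynomial.aeval_X, eq_intCast,
        map_intCast]
      linear_combination -hchar
  let x : 𝓞 K := ⟨c, hc⟩
  have hx : x * (((t : 𝓞 K) - x) * (D : 𝓞 K)) = 1 := by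
    apply RingOfIntegers.ext
    have hD' : (D : K) * D = 1 := by exact_mod_cast hD
    have hxc : (x : K) = c := rfl
    simp only [map_mul, map_sub, map_intCast, map_one, hxc]
    linear_combination (D : K) * hchar + hD'
  exact ⟨Units.mkOfMulEqOne _ _ hx, rfl⟩

/-- If `r * α` is a unit of `𝓞 K`, then `q^*(α)` and `q(r)` agree. -/
theorem qRat_eq_qstar_of_mul_eq_unit {K : Type*} [Field K] [NumberField K] (𝔽 : Type*) [Field 𝔽]
    {r : ℚ} (hr : r ≠ 0) {α : K} (u : (𝓞 K)ˣ)
    (hu : algebraMap (𝓞 K) K u = algebraMap ℚ K r * α) : qRat K 𝔽 r = qstar K 𝔽 α := by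
  unfold qRat qstar
  have hsec := IsLocalization.sec_spec (nonZeroDivisors (𝓞 K)) α
  set x := (IsLocalization.sec (nonZeroDivisors (𝓞 K)) α).1
  set s := (IsLocalization.sec (nonZeroDivisors (𝓞 K)) α).2
  have hs : (s : 𝓞 K) ≠ 0 := nonZeroDivisors.coe_ne_zero s
  have hnum : r.num ≠ 0 := Rat.num_ne_zero.mpr hr
  have hden : r.den ≠ 0 := r.den_ne_zero
  have hrK : algebraMap ℚ K r * (r.den : K) = (r.num : K) := by
    have h := congrArg (algebraMap ℚ K) (Rat.mul_den_eq_num r)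
    rwa [map_mul, map_natCast, map_intCast] at h
  have heq : (r.num : 𝓞 K) * x = (u : 𝓞 K) * ((r.den : 𝓞 K) * (s : 𝓞 K)) := by
    apply RingOfIntegers.ext
    simp only [map_mul, map_intCast, map_natCast]
    rw [← hsec, ← hrK, hu]
    ring
  have hn : (r.num : 𝓞 K) ≠ 0 := by exact_mod_cast hnum
  have hd : (r.den : 𝓞 K) ≠ 0 := by exact_mod_cast hden
  have hx : x ≠ 0 := by
    intro h
    rw [h, mul_zero] at heq
    exact mul_ne_zero u.ne_zero (mul_ne_zero hd hs) heq.symm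
  have hcount := congrArg (inertCount K) heq
  rw [inertCount_mul hn hx, inertCount_mul u.ne_zero (mul_ne_zero hd hs), inertCount_mul hd hs,
    inertCount_of_isUnit u.isUnit, inertCount_intCast K hnum, inertCount_natCast K hden] at hcount
  rw [neg_one_pow_eq_pow_mod_two, neg_one_pow_eq_pow_mod_two (inertCount K x + _)]
  congr 1
  omega


/-- STATEMENT 10.  Let `ζ = rI ∈ Z` with `r ∈ ℚ^× ∩ K_{S₀}`, let `α ∈ K_{S,q}` and let
`y ∈ Y`.  If `ζ·r_y(α) ∈ GL(2,ℤ)`, then `q(ζ) = 1`.  (Here `g = r_y(α)` is the unique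
rational matrix with `g·y = y·α`, and `ζ·r_y(α)` is the matrix `r • g`.) -/
theorem statement_10 (K : Type) [Field K] [NumberField K]
    (hdeg : Module.finrank ℚ K = 2) (hreal : Nonempty (K →+* ℝ))
    (ω : 𝓞 K) (hω : Algebra.adjoin ℤ {ω} = ⊤)
    (𝔽 : Type) [Field 𝔽] (hchar : ringChar 𝔽 ≠ 2)
    (N Mlev : ℕ) (hN : 0 < N) (hMlev : 3 ≤ Mlev) (hdvd : Mlev ∣ pdN 𝔽 K N)
    (r : ℚ) (hr : r ≠ 0)
    (hrZ : algebraMap ℚ K r ∈ KS0set K (pdN 𝔽 K N) (algebraMap (𝓞 K) K ω))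
    (α : K) (hα : α ∈ KSqSet K 𝔽 (pdN 𝔽 K N) Mlev (algebraMap (𝓞 K) K ω))
    (y : Ysub K) (g : Matrix (Fin 2) (Fin 2) ℚ)
    (hg : act g y.1 = rsc y.1 α)
    (hGL : (r • g) ∈ GLZset) :
    qRat K 𝔽 r = 1 := by
  obtain ⟨u, hu⟩ := exists_unit_of_act_eq_rsc hGL y.2.1 (c := algebraMap ℚ K r * α) (by
    have h : act (r • g) y.1 = algebraMap ℚ K r • act g y.1 := by
      ext i
      simp only [act, Matrix.mulVec, dotProduct, Fin.sum_univ_two, Matrix.map_apply,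
        Matrix.smul_apply, Pi.smul_apply, smul_eq_mul, map_mul]
      ring
    rw [h, hg]
    ext i
    simp [rsc]
    ring)
  rw [qRat_eq_qstar_of_mul_eq_unit 𝔽 hr u hu, hα.2]

end AD
end
end
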